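/- For every 6-dimensional subspace W ⊆ ℝ⁸ there exists a linear map J : W → W with J ∘ J = −id and ⟨J x, J y⟩ = ⟨x, y⟩ for all x, y ∈ W such that, setting ω(x,y) := ⟨J x, y⟩, one has Φ₀(a,b,c,d) = −( ω(a,b)·ω(c,d) − ω(a,c)·ω(b,d) + ω(a,d)·ω(b,c) ) for all a, b, c, d ∈ W. (That is, the restriction of the Cayley form Φ₀ to any 6-dimensional subspace equals −½ ω∧ω for a nondegenerate 2-form ω coming from an orthogonal complex structure on W; this is the pointwise content of the identity ½ω² = −Φ|_W for ω = −∗_W(Φ|_W).) -/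

import Mathlib

open scoped RealInnerProductSpace

noncomputable section

abbrev E8 := EuclideanSpace ℝ (Fin 8)

/-- The 4-form `dx_{ijkl}` on `ℝ⁸`. -/
def dx4 (i j k l : Fin 8) (v : Fin 4 → E8) : ℝ :=
  Matrix.det (Matrix.of fun r s : Fin 4 => v s (![i, j, k, l] r))

/-- The Cayley 4-form `Φ₀` on `ℝ⁸`. -/
def Phi0 (v : Fin 4 → E8) : ℝ :=
  dx4 0 1 2 3 v + dx4 0 1 4 5 v - dx4 0 1 6 7 v + dx4 0 2 4 6 v + dx4 0 2 5 7 v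
    + dx4 0 3 4 7 v - dx4 0 3 5 6 v - dx4 1 2 4 7 v + dx4 1 2 5 6 v + dx4 1 3 4 6 v
    + dx4 1 3 5 7 v - dx4 2 3 4 5 v + dx4 2 3 6 7 v + dx4 4 5 6 7 v

/-- The Cayley form applied to four vectors. -/
def Phi (a b c d : E8) : ℝ := Phi0 ![a, b, c, d]

/-- The `i`-th standard basis vector of `ℝ⁸`. -/
def stdB (i : Fin 8) : E8 := EuclideanSpace.single i 1

/-- The triple cross product: the unique vector with `⟪x, u×v×w⟫ = Φ₀(x,u,v,w)`
for all `x`. -/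
def crossTriple (u v w : E8) : E8 :=
  (EuclideanSpace.equiv (Fin 8) ℝ).symm fun i => Phi (stdB i) u v w

/-- A 4-dimensional subspace of `ℝ⁸` is Cayley if it has an orthonormal basis on which
`Φ₀` takes the value `1`. -/
def IsCayley (V : Submodule ℝ E8) : Prop :=
  Module.finrank ℝ V = 4 ∧
    ∃ v : Fin 4 → E8, (∀ i, v i ∈ V) ∧ Orthonormal ℝ v ∧ Phi0 v = 1

/-- The Plücker coordinate of `a ∧ b` at the indices `p`, `q`. -/
def minor (a b : E8) (p q : Fin 8) : ℝ := a p * b q - a q * b p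

/-- The 2-form obtained by contracting `Φ₀` with the bivector whose coordinates are `m`. -/
def contraction (m : Fin 8 → Fin 8 → ℝ) : Fin 8 → Fin 8 → ℝ
  | 0, 0 => 0
  | 0, 1 => m 2 3 + m 4 5 - m 6 7
  | 0, 2 => -m 1 3 + m 4 6 + m 5 7
  | 0, 3 => m 1 2 + m 4 7 - m 5 6
  | 0, 4 => -m 1 5 - m 2 6 - m 3 7
  | 0, 5 => m 1 4 - m 2 7 + m 3 6
  | 0, 6 => m 1 7 + m 2 4 - m 3 5
  | 0, 7 => -m 1 6 + m 2 5 + m 3 4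
  | 1, 0 => -m 2 3 - m 4 5 + m 6 7
  | 1, 1 => 0
  | 1, 2 => m 0 3 - m 4 7 + m 5 6
  | 1, 3 => -m 0 2 + m 4 6 + m 5 7
  | 1, 4 => m 0 5 + m 2 7 - m 3 6
  | 1, 5 => -m 0 4 - m 2 6 - m 3 7
  | 1, 6 => -m 0 7 + m 2 5 + m 3 4
  | 1, 7 => m 0 6 - m 2 4 + m 3 5
  | 2, 0 => m 1 3 - m 4 6 - m 5 7
  | 2, 1 => -m 0 3 + m 4 7 - m 5 6
  | 2, 2 => 0
  | 2, 3 => m 0 1 - m 4 5 + m 6 7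
  | 2, 4 => m 0 6 - m 1 7 + m 3 5
  | 2, 5 => m 0 7 + m 1 6 - m 3 4
  | 2, 6 => -m 0 4 - m 1 5 - m 3 7
  | 2, 7 => -m 0 5 + m 1 4 + m 3 6
  | 3, 0 => -m 1 2 - m 4 7 + m 5 6
  | 3, 1 => m 0 2 - m 4 6 - m 5 7
  | 3, 2 => -m 0 1 + m 4 5 - m 6 7
  | 3, 3 => 0
  | 3, 4 => m 0 7 + m 1 6 - m 2 5
  | 3, 5 => -m 0 6 + m 1 7 + m 2 4
  | 3, 6 => m 0 5 - m 1 4 + m 2 7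
  | 3, 7 => -m 0 4 - m 1 5 - m 2 6
  | 4, 0 => m 1 5 + m 2 6 + m 3 7
  | 4, 1 => -m 0 5 - m 2 7 + m 3 6
  | 4, 2 => -m 0 6 + m 1 7 - m 3 5
  | 4, 3 => -m 0 7 - m 1 6 + m 2 5
  | 4, 4 => 0
  | 4, 5 => m 0 1 - m 2 3 + m 6 7
  | 4, 6 => m 0 2 + m 1 3 - m 5 7
  | 4, 7 => m 0 3 - m 1 2 + m 5 6
  | 5, 0 => -m 1 4 + m 2 7 - m 3 6
  | 5, 1 => m 0 4 + m 2 6 + m 3 7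
  | 5, 2 => -m 0 7 - m 1 6 + m 3 4
  | 5, 3 => m 0 6 - m 1 7 - m 2 4
  | 5, 4 => -m 0 1 + m 2 3 - m 6 7
  | 5, 5 => 0
  | 5, 6 => -m 0 3 + m 1 2 + m 4 7
  | 5, 7 => m 0 2 + m 1 3 - m 4 6
  | 6, 0 => -m 1 7 - m 2 4 + m 3 5
  | 6, 1 => m 0 7 - m 2 5 - m 3 4
  | 6, 2 => m 0 4 + m 1 5 + m 3 7
  | 6, 3 => -m 0 5 + m 1 4 - m 2 7
  | 6, 4 => -m 0 2 - m 1 3 + m 5 7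
  | 6, 5 => m 0 3 - m 1 2 - m 4 7
  | 6, 6 => 0
  | 6, 7 => -m 0 1 + m 2 3 + m 4 5
  | 7, 0 => m 1 6 - m 2 5 - m 3 4
  | 7, 1 => -m 0 6 + m 2 4 - m 3 5
  | 7, 2 => m 0 5 - m 1 4 - m 3 6
  | 7, 3 => m 0 4 + m 1 5 + m 2 6
  | 7, 4 => -m 0 3 + m 1 2 - m 5 6
  | 7, 5 => -m 0 2 - m 1 3 + m 4 6
  | 7, 6 => m 0 1 - m 2 3 - m 4 5
  | 7, 7 => 0

/-- The coefficient matrix of the 2-form `Φ₀(a, b, ·, ·)`. -/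
def contractionMatrix (a b : E8) : Fin 8 → Fin 8 → ℝ :=
  contraction (minor a b)

theorem dx4_apply (i j k l : Fin 8) (a b c d : E8) :
    dx4 i j k l ![a, b, c, d] =
      (a i * b j - a j * b i) * (c k * d l - c l * d k)
        - (a i * b k - a k * b i) * (c j * d l - c l * d j)
        + (a i * b l - a l * b i) * (c j * d k - c k * d j)
        + (a j * b k - a k * b j) * (c i * d l - c l * d i)
        - (a j * b l - a l * b j) * (c i * d k - c k * d i)
        + (a k * b l - a l * b k) * (c i * d j - c j * d i) := by
  simp [dx4, Matrix.det_succ_row_zero, Fin.sum_univ_succ, Fin.succAbove]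
  ring

theorem Phi_eq_sum (a b c d : E8) :
    Phi a b c d = ∑ j, ∑ k, contractionMatrix a b j k * (c j * d k) := by
  simp only [Phi, Phi0, dx4_apply, Fin.sum_univ_eight]
  simp only [contractionMatrix, contraction, minor]
  ring

theorem Phi_swap_left (a b c d : E8) : Phi b a c d = -Phi a b c d := by
  simp only [Phi, Phi0, dx4_apply]
  ring

theorem Phi_swap_middle (a b c d : E8) : Phi a c b d = -Phi a b c d := by
  simp only [Phi, Phi0, dx4_apply]
  ring

theorem Phi_swap_right (a b c d : E8) : Phi a b d c = -Phi a b c d := by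
  simp only [Phi, Phi0, dx4_apply]
  ring

theorem inner_eq_sum (x y : E8) : (⟪x, y⟫ : ℝ) = ∑ i, x i * y i := by
  simp [PiLp.inner_apply, mul_comm]

theorem crossTriple_apply (u v w : E8) (i : Fin 8) :
    crossTriple u v w i = ∑ k, contractionMatrix u v i k * w k := by
  have h : crossTriple u v w i = Phi (stdB i) u v w := rfl
  rw [h, Phi_swap_left, Phi_swap_middle, neg_neg, Phi_eq_sum, Finset.sum_eq_single i]
  · simp [stdB]
  · intro j _ hj
    simp [stdB, hj]
  · simp

theorem inner_crossTriple (a u v w : E8) : (⟪a, crossTriple u v w⟫ : ℝ) = Phi a u v w := by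
  rw [Phi_swap_left, Phi_swap_middle, neg_neg, Phi_eq_sum, inner_eq_sum]
  simp only [crossTriple_apply, Finset.mul_sum]
  exact Finset.sum_congr rfl fun j _ => Finset.sum_congr rfl fun k _ => by ring

theorem contraction_linear (r₁ r₂ r₃ r₄ : ℝ) (m₁ m₂ m₃ m₄ : Fin 8 → Fin 8 → ℝ) (j k : Fin 8) :
    contraction (fun p q => r₁ * m₁ p q - r₂ * m₂ p q - r₃ * m₃ p q + r₄ * m₄ p q) j k =
      r₁ * contraction m₁ j k - r₂ * contraction m₂ j k - r₃ * contraction m₃ j k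
        + r₄ * contraction m₄ j k := by
  fin_cases j <;> fin_cases k <;>
    simp only [Fin.isValue, contraction] <;> ring

set_option maxRecDepth 10000 in
set_option maxHeartbeats 4000000 in
theorem sum_contraction_mul (m n : Fin 8 → Fin 8 → ℝ) (hm : ∀ p, m p p = 0) (hn : ∀ p, n p p = 0)
    (hm' : ∀ p q, q < p → m p q = -m q p) (hn' : ∀ p q, q < p → n p q = -n q p) (j k : Fin 8) :
    ∑ i, contraction m i j * contraction n i k =
      (if j = k then (∑ p, ∑ q, (m p q - contraction m p q) * n p q) / 2 else 0)
        - ∑ i, m k i * n j i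
        + contraction (fun p q => ∑ i, (m i p * n i q - m i q * n i p)) j k
        + ∑ i, contraction n j i * m k i + ∑ i, contraction m k i * n j i := by
  simp only [Fin.sum_univ_eight]
  fin_cases j <;> fin_cases k <;>
    simp only [Fin.reduceFinMk, Fin.zero_eta, Fin.mk_one, Fin.isValue, contraction,
      Fin.reduceEq, Fin.reduceLT, eq_self, ↓reduceIte, hm, hn, hm', hn'] <;>
    ring

theorem sum_contractionMatrix_mul (x y u v : E8) (j k : Fin 8) :
    ∑ i, contractionMatrix x y i j * contractionMatrix u v i k =
      (if j = k then ⟪x, u⟫ * ⟪y, v⟫ - ⟪x, v⟫ * ⟪y, u⟫ - Phi x y u v else 0)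
        - x k * ⟪y, v⟫ * u j + x k * ⟪y, u⟫ * v j + y k * ⟪x, v⟫ * u j - y k * ⟪x, u⟫ * v j
        + ⟪x, u⟫ * contractionMatrix y v j k - ⟪x, v⟫ * contractionMatrix y u j k
        - ⟪y, u⟫ * contractionMatrix x v j k + ⟪y, v⟫ * contractionMatrix x u j k
        + x k * crossTriple u v y j - y k * crossTriple u v x j
        + u j * crossTriple x y v k - v j * crossTriple x y u k := by
  have hmn (a b : E8) (p q : Fin 8) : minor a b p q = -minor a b q p := by
    simp only [minor]
    ring
  have h0 (a b : E8) (p : Fin 8) : minor a b p p = 0 := sub_self _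
  have trace : (∑ p, ∑ q, (minor x y p q - contraction (minor x y) p q) * minor u v p q) / 2 =
      ⟪x, u⟫ * ⟪y, v⟫ - ⟪x, v⟫ * ⟪y, u⟫ - Phi x y u v := by
    have gram : ∑ p, ∑ q, minor x y p q * minor u v p q =
        2 * (⟪x, u⟫ * ⟪y, v⟫ - ⟪x, v⟫ * ⟪y, u⟫) := by
      simp only [inner_eq_sum, minor, Fin.sum_univ_eight]
      ring
    have cayley : ∑ p, ∑ q, contraction (minor x y) p q * minor u v p q =
        Phi x y u v - Phi x y v u := by
      simp only [Phi_eq_sum, contractionMatrix, ← Finset.sum_sub_distrib]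
      refine Finset.sum_congr rfl fun p _ => Finset.sum_congr rfl fun q _ => ?_
      simp only [minor]
      ring
    simp only [sub_mul, Finset.sum_sub_distrib]
    rw [gram, cayley, Phi_swap_right]
    ring
  have bivector (p q : Fin 8) :
      ∑ i, (minor x y i p * minor u v i q - minor x y i q * minor u v i p) =
        ⟪x, u⟫ * minor y v p q - ⟪x, v⟫ * minor y u p q - ⟪y, u⟫ * minor x v p q
          + ⟪y, v⟫ * minor x u p q := by
    simp only [inner_eq_sum, Finset.sum_mul, ← Finset.sum_sub_distrib, ← Finset.sum_add_distrib]
    refine Finset.sum_congr rfl fun i _ => ?_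
    simp only [minor]
    ring
  have gram_jk : ∑ i, minor x y k i * minor u v j i =
      x k * ⟪y, v⟫ * u j - x k * ⟪y, u⟫ * v j - y k * ⟪x, v⟫ * u j + y k * ⟪x, u⟫ * v j := by
    simp only [inner_eq_sum, Finset.mul_sum, Finset.sum_mul, ← Finset.sum_sub_distrib,
      ← Finset.sum_add_distrib]
    refine Finset.sum_congr rfl fun i _ => ?_
    simp only [minor]
    ring
  have cross (a b c d : E8) (j k : Fin 8) : ∑ i, contraction (minor c d) j i * minor a b k i =
      a k * crossTriple c d b j - b k * crossTriple c d a j := by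
    simp only [crossTriple_apply, contractionMatrix, Finset.mul_sum, ← Finset.sum_sub_distrib]
    refine Finset.sum_congr rfl fun i _ => ?_
    simp only [minor]
    ring
  simp only [contractionMatrix]
  rw [sum_contraction_mul _ _ (h0 x y) (h0 u v) (fun p q _ => hmn x y p q)
    (fun p q _ => hmn u v p q), trace, gram_jk, cross, cross]
  simp only [bivector, contraction_linear]
  ring

/-- The inner product of two triple cross products. -/
theorem inner_crossTriple_crossTriple (x y z u v w : E8) :
    (⟪crossTriple x y z, crossTriple u v w⟫ : ℝ) =
      ⟪z, w⟫ * (⟪x, u⟫ * ⟪y, v⟫ - ⟪x, v⟫ * ⟪y, u⟫ - Phi x y u v)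
        - ⟪x, w⟫ * ⟪y, v⟫ * ⟪z, u⟫ + ⟪x, w⟫ * ⟪y, u⟫ * ⟪z, v⟫
        + ⟪y, w⟫ * ⟪x, v⟫ * ⟪z, u⟫ - ⟪y, w⟫ * ⟪x, u⟫ * ⟪z, v⟫
        + ⟪x, u⟫ * Phi y v z w - ⟪x, v⟫ * Phi y u z w
        - ⟪y, u⟫ * Phi x v z w + ⟪y, v⟫ * Phi x u z w
        + ⟪x, w⟫ * Phi z u v y - ⟪y, w⟫ * Phi z u v x
        + ⟪z, u⟫ * Phi w x y v - ⟪z, v⟫ * Phi w x y u := by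
  have expand : (⟪crossTriple x y z, crossTriple u v w⟫ : ℝ) = ∑ j, ∑ k,
      (∑ i, contractionMatrix x y i j * contractionMatrix u v i k) * (z j * w k) := by
    simp only [inner_eq_sum, crossTriple_apply, Finset.sum_mul_sum]
    rw [Finset.sum_comm]
    refine Finset.sum_congr rfl fun j _ => ?_
    rw [Finset.sum_comm]
    refine Finset.sum_congr rfl fun k _ => ?_
    rw [Finset.sum_mul]
    exact Finset.sum_congr rfl fun i _ => by ring
  have inner_zw (r : ℝ) : ⟪z, w⟫ * r = ∑ j, ∑ k, (if j = k then r else 0) * (z j * w k) := by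
    simp [inner_eq_sum, Finset.sum_mul, mul_comm r]
  have prod (f g : Fin 8 → ℝ) :
      (∑ j, f j * z j) * (∑ k, g k * w k) = ∑ j, ∑ k, f j * g k * (z j * w k) := by
    rw [Finset.sum_mul_sum]
    exact Finset.sum_congr rfl fun j _ => Finset.sum_congr rfl fun k _ => by ring
  have inner_z (a : E8) : (⟪z, a⟫ : ℝ) = ∑ j, a j * z j := by
    simp only [inner_eq_sum, mul_comm]
  have inner_w (a : E8) : (⟪a, w⟫ : ℝ) = ∑ k, a k * w k := inner_eq_sum a w
  have Phi_z (a b c : E8) : Phi z a b c = ∑ j, crossTriple a b c j * z j := by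
    rw [← inner_crossTriple, inner_z]
  have Phi_w (a b c : E8) : Phi w a b c = ∑ k, crossTriple a b c k * w k := by
    rw [← inner_crossTriple, real_inner_comm, inner_w]
  have regroup :
      ⟪z, w⟫ * (⟪x, u⟫ * ⟪y, v⟫ - ⟪x, v⟫ * ⟪y, u⟫ - Phi x y u v)
        - ⟪x, w⟫ * ⟪y, v⟫ * ⟪z, u⟫ + ⟪x, w⟫ * ⟪y, u⟫ * ⟪z, v⟫
        + ⟪y, w⟫ * ⟪x, v⟫ * ⟪z, u⟫ - ⟪y, w⟫ * ⟪x, u⟫ * ⟪z, v⟫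
        + ⟪x, u⟫ * Phi y v z w - ⟪x, v⟫ * Phi y u z w
        - ⟪y, u⟫ * Phi x v z w + ⟪y, v⟫ * Phi x u z w
        + ⟪x, w⟫ * Phi z u v y - ⟪y, w⟫ * Phi z u v x
        + ⟪z, u⟫ * Phi w x y v - ⟪z, v⟫ * Phi w x y u =
      ⟪z, w⟫ * (⟪x, u⟫ * ⟪y, v⟫ - ⟪x, v⟫ * ⟪y, u⟫ - Phi x y u v)
        - ⟪y, v⟫ * (⟪z, u⟫ * ⟪x, w⟫) + ⟪y, u⟫ * (⟪z, v⟫ * ⟪x, w⟫)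
        + ⟪x, v⟫ * (⟪z, u⟫ * ⟪y, w⟫) - ⟪x, u⟫ * (⟪z, v⟫ * ⟪y, w⟫)
        + ⟪x, u⟫ * Phi y v z w - ⟪x, v⟫ * Phi y u z w
        - ⟪y, u⟫ * Phi x v z w + ⟪y, v⟫ * Phi x u z w
        + Phi z u v y * ⟪x, w⟫ - Phi z u v x * ⟪y, w⟫
        + ⟪z, u⟫ * Phi w x y v - ⟪z, v⟫ * Phi w x y u := by
    ring
  rw [expand, regroup, inner_zw]
  simp only [sum_contractionMatrix_mul, inner_z, inner_w, Phi_z, Phi_w, prod,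
    Phi_eq_sum _ _ z w, Finset.mul_sum, ← Finset.sum_add_distrib, ← Finset.sum_sub_distrib]
  exact Finset.sum_congr rfl fun j _ => Finset.sum_congr rfl fun k _ => by ring

theorem Phi_add_left (a a' b c d : E8) : Phi (a + a') b c d = Phi a b c d + Phi a' b c d := by
  simp only [← inner_crossTriple, inner_add_left]

theorem Phi_smul_left (r : ℝ) (a b c d : E8) : Phi (r • a) b c d = r * Phi a b c d := by
  simp only [← inner_crossTriple, real_inner_smul_left]

theorem Phi_self_left (a b c : E8) : Phi a a b c = 0 := by
  linarith [Phi_swap_left a a b c]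

theorem Phi_self_right (a b c : E8) : Phi a b c c = 0 := by
  linarith [Phi_swap_right a b c c]

/-- The linear map `x ↦ p × q × x`. -/
def crossLinear (p q : E8) : E8 →ₗ[ℝ] E8 where
  toFun := crossTriple p q
  map_add' x y := by
    ext i
    simp [crossTriple_apply, mul_add, Finset.sum_add_distrib]
  map_smul' r x := by
    ext i
    simp [crossTriple_apply, Finset.mul_sum, mul_left_comm]

theorem inner_crossTriple_left (p q x y : E8) :
    (⟪crossTriple p q x, y⟫ : ℝ) = -Phi p q x y := by
  rw [real_inner_comm, inner_crossTriple, Phi_swap_left, Phi_swap_middle, Phi_swap_right]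
  ring

theorem inner_crossTriple_of_orthonormal {p q x y : E8} (hp : (⟪p, p⟫ : ℝ) = 1)
    (hq : (⟪q, q⟫ : ℝ) = 1) (hpq : (⟪p, q⟫ : ℝ) = 0) (hpy : (⟪p, y⟫ : ℝ) = 0)
    (hqy : (⟪q, y⟫ : ℝ) = 0) :
    (⟪crossTriple p q x, crossTriple p q y⟫ : ℝ) = ⟪x, y⟫ := by
  have hqp : (⟪q, p⟫ : ℝ) = 0 := by rw [real_inner_comm, hpq]
  rw [inner_crossTriple_crossTriple, Phi_swap_middle p p q q, Phi_self_left]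
  have h1 : Phi q q x y = 0 := Phi_self_left ..
  have h2 : Phi p p x y = 0 := Phi_self_left ..
  have h3 : Phi y p q q = 0 := Phi_self_right ..
  have h4 : Phi y p q p = 0 := by rw [Phi_swap_middle, Phi_self_right, neg_zero]
  rw [hp, hq, hpq, hqp, hpy, hqy, h1, h2, h3, h4]
  ring

theorem Phi_crossTriple {p q x b c d : E8} (hpb : (⟪p, b⟫ : ℝ) = 0) (hpc : (⟪p, c⟫ : ℝ) = 0)
    (hpd : (⟪p, d⟫ : ℝ) = 0) (hqb : (⟪q, b⟫ : ℝ) = 0) (hqc : (⟪q, c⟫ : ℝ) = 0)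
    (hqd : (⟪q, d⟫ : ℝ) = 0) :
    Phi (crossTriple p q x) b c d =
      ⟪x, b⟫ * ⟪crossTriple p q c, d⟫ - ⟪x, c⟫ * ⟪crossTriple p q b, d⟫
        + ⟪x, d⟫ * ⟪crossTriple p q b, c⟫ := by
  have cyclic (y : E8) : Phi d p q y = -Phi p q y d := by
    rw [← inner_crossTriple, real_inner_comm, inner_crossTriple_left]
  rw [← inner_crossTriple, inner_crossTriple_crossTriple, hpb, hpc, hpd, hqb, hqc, hqd,
    cyclic, cyclic]
  simp only [inner_crossTriple_left]
  ring

/-- On any 6-dimensional subspace `W ⊆ ℝ⁸` there is an orthogonal complex structure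
`J` such that, with `ω(x,y) = ⟪Jx,y⟫`, the restriction of the Cayley form to `W` is
`−½ ω∧ω`:
`Φ₀(a,b,c,d) = −(ω(a,b)ω(c,d) − ω(a,c)ω(b,d) + ω(a,d)ω(b,c))` for `a,b,c,d ∈ W`. -/
theorem phi_restricted_to_six_dim (W : Submodule ℝ E8)
    (hW : Module.finrank ℝ W = 6) :
    ∃ J : W →ₗ[ℝ] W, (∀ x : W, J (J x) = -x) ∧
      (∀ x y : W, (⟪J x, J y⟫ : ℝ) = ⟪x, y⟫) ∧
      ∀ a b c d : W,
        Phi (a : E8) (b : E8) (c : E8) (d : E8) =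
          -((⟪J a, b⟫ : ℝ) * (⟪J c, d⟫ : ℝ) - (⟪J a, c⟫ : ℝ) * (⟪J b, d⟫ : ℝ)
            + (⟪J a, d⟫ : ℝ) * (⟪J b, c⟫ : ℝ)) := by
  have hW' : Module.finrank ℝ Wᗮ = 2 := by
    have h := W.finrank_add_finrank_orthogonal
    rw [hW, finrank_euclideanSpace_fin] at h
    omega
  let e := (stdOrthonormalBasis ℝ Wᗮ).reindex (finCongr hW')
  let p : E8 := (e 0).1
  let q : E8 := (e 1).1
  have inner_e (i j : Fin 2) : (⟪(e i : E8), (e j : E8)⟫ : ℝ) = if i = j then 1 else 0 :=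
    orthonormal_iff_ite.mp e.orthonormal i j
  have hp : (⟪p, p⟫ : ℝ) = 1 := inner_e 0 0
  have hq : (⟪q, q⟫ : ℝ) = 1 := inner_e 1 1
  have hpq : (⟪p, q⟫ : ℝ) = 0 := inner_e 0 1
  have hpW (x : W) : (⟪p, x⟫ : ℝ) = 0 := W.inner_left_of_mem_orthogonal x.2 (e 0).2
  have hqW (x : W) : (⟪q, x⟫ : ℝ) = 0 := W.inner_left_of_mem_orthogonal x.2 (e 1).2
  have mem (x : E8) : crossLinear p q x ∈ W := by
    rw [← W.orthogonal_orthogonal, Submodule.mem_orthogonal]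
    intro v hv
    have hsum := congrArg Subtype.val (e.sum_repr ⟨v, hv⟩)
    rw [Fin.sum_univ_two] at hsum
    change _ • p + _ • q = v at hsum
    change ⟪v, crossTriple p q x⟫ = 0
    rw [inner_crossTriple, ← hsum, Phi_add_left, Phi_smul_left, Phi_smul_left, Phi_self_left,
      Phi_swap_middle, Phi_self_left]
    ring
  let J : W →ₗ[ℝ] W := ((crossLinear p q).comp W.subtype).codRestrict W fun x => mem x
  have coe_J (x : W) : (J x : E8) = crossTriple p q x := rfl
  have inner_J (x y : W) : (⟪J x, J y⟫ : ℝ) = ⟪x, y⟫ :=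
    inner_crossTriple_of_orthonormal hp hq hpq (hpW y) (hqW y)
  have skew_J (x y : W) : (⟪J x, y⟫ : ℝ) = -⟪x, J y⟫ := by
    rw [real_inner_comm (J y) x, Submodule.coe_inner, Submodule.coe_inner, coe_J, coe_J,
      inner_crossTriple_left, inner_crossTriple_left, Phi_swap_right]
  have J_J (x : W) : J (J x) = -x := by
    refine ext_inner_right ℝ fun y => ?_
    rw [skew_J, inner_J, inner_neg_left]
  refine ⟨J, J_J, inner_J, fun a b c d => ?_⟩
  have ha : (a : E8) = crossTriple p q (J (-a) : W) := by
    rw [← coe_J, J_J, neg_neg]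
  rw [ha, Phi_crossTriple (hpW b) (hpW c) (hpW d) (hqW b) (hqW c) (hqW d)]
  simp only [← coe_J, ← Submodule.coe_inner, map_neg, inner_neg_left]
  ring

end
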